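/- Let {σ^(k)}_{k=1,...,n} be n spin configurations drawn i.i.d. from an Ising model with zero magnetic field on p spins with maximum degree d and maximum coupling intensity β, and fix a node u ∈ V. For any ε₄ > 0 and R > 0, if n ≥ 2^11 · d²(d+1)² · e^{4βd} · ln(p²/ε₄), then with probability at least 1 − ε₄ the Interaction Screening Objective satisfies δS_n(Δ_u, θ*_u) ≥ (e^{−3βd} / (4(d+1)(1 + 2√d·R))) · ‖Δ_u‖₂² simultaneously for all Δ_u ∈ ℝ^{p−1} with ‖Δ_u‖₁ ≤ 4√d·‖Δ_u‖₂ and ‖Δ_u‖₂ ≤ R. -/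

import Mathlib

open scoped BigOperators Classical

noncomputable section

/-- The ±1 spin value associated to a Boolean. -/
def spin (b : Bool) : ℝ := if b then 1 else -1

/-- The energy term of the zero-field Ising model with (symmetric, zero-diagonal)
couplings `θ`: the sum over undirected edges of `θ i j * σ_i * σ_j`. -/
def ham {p : ℕ} (θ : Fin p → Fin p → ℝ) (σ : Fin p → Bool) : ℝ :=
  (1 / 2) * ∑ i, ∑ j, θ i j * spin (σ i) * spin (σ j)

/-- The Gibbs probability `μ(σ) = exp(ham θ σ) / Z`. -/
def gibbs {p : ℕ} (θ : Fin p → Fin p → ℝ) (σ : Fin p → Bool) : ℝ :=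
  Real.exp (ham θ σ) / ∑ τ : Fin p → Bool, Real.exp (ham θ τ)

/-- Probability of the event `P` under `n` i.i.d. samples from the Ising model. -/
def probn {p : ℕ} (θ : Fin p → Fin p → ℝ) (n : ℕ)
    (P : (Fin n → Fin p → Bool) → Prop) : ℝ :=
  ∑ σs : Fin n → Fin p → Bool, if P σs then ∏ k, gibbs θ (σs k) else 0

/-- The Interaction Screening Objective at node `u`. -/
def ISO {p : ℕ} (n : ℕ) (σs : Fin n → Fin p → Bool) (u : Fin p) (θu : Fin p → ℝ) : ℝ :=
  (1 / n : ℝ) *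
    ∑ k, Real.exp (-∑ i ∈ Finset.univ.erase u, θu i * spin (σs k u) * spin (σs k i))

/-- The gradient (vector of partial derivatives) of the Interaction Screening Objective. -/
def gradISO {p : ℕ} (n : ℕ) (σs : Fin n → Fin p → Bool) (u : Fin p) (θu : Fin p → ℝ)
    (l : Fin p) : ℝ :=
  (1 / n : ℝ) *
    ∑ k, (-(spin (σs k u) * spin (σs k l))) *
      Real.exp (-∑ i ∈ Finset.univ.erase u, θu i * spin (σs k u) * spin (σs k i))

/-- ℓ₁-norm of a coupling vector around node `u` (the `u`-entry is excluded). -/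
def l1 {p : ℕ} (u : Fin p) (x : Fin p → ℝ) : ℝ := ∑ i ∈ Finset.univ.erase u, |x i|

/-- ℓ₂-norm of a coupling vector around node `u` (the `u`-entry is excluded). -/
def l2 {p : ℕ} (u : Fin p) (x : Fin p → ℝ) : ℝ :=
  Real.sqrt (∑ i ∈ Finset.univ.erase u, x i ^ 2)

lemma screen_ineq (z : ℝ) : z ^ 2 / (2 + |z|) ≤ Real.exp (-z) - 1 + z := by
  rcases le_total 0 z with h | h
  · rw [abs_of_nonneg h, div_le_iff₀ (by linarith)]
    have key : (2 - z) ≤ (2 + z) * Real.exp (-z) := by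
      rcases lt_or_ge z 2 with h2 | h2
      · have h3 := Real.exp_le_two_add_div_two_sub h h2
        rw [le_div_iff₀ (by linarith)] at h3
        have h4 : Real.exp z * Real.exp (-z) = 1 := by
          rw [← Real.exp_add]; simp
        have h5 := mul_le_mul_of_nonneg_right h3 (Real.exp_pos (-z)).le
        nlinarith
      · have := Real.exp_pos (-z)
        nlinarith [mul_nonneg (by linarith : (0:ℝ) ≤ 2 + z) this.le]
    nlinarith
  · rw [abs_of_nonpos h, div_le_iff₀ (by linarith)]
    have h3 := Real.quadratic_le_exp_of_nonneg (x := -z) (by linarith)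
    have h4 := mul_le_mul_of_nonneg_right h3 (by linarith : (0:ℝ) ≤ 2 + -z)
    nlinarith [mul_nonneg (by linarith : (0:ℝ) ≤ -z) (sq_nonneg z)]

lemma hoeff {α : Type*} [Fintype α] (w f : α → ℝ) (hw : ∀ a, 0 ≤ w a)
    (hw1 : ∑ a, w a = 1) (hf : ∀ a, |f a| ≤ 1) (s : ℝ) :
    ∑ a, w a * Real.exp (s * (f a - ∑ b, w b * f b)) ≤ Real.exp (s ^ 2 / 2) := by
  let m0 : MeasurableSpace α := ⊤
  let μ : MeasureTheory.Measure α :=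
    ∑ a, ENNReal.ofReal (w a) • MeasureTheory.Measure.dirac a
  have hinteg : ∀ g : α → ℝ, ∫ x, g x ∂μ = ∑ a, w a * g a := by
    intro g
    rw [MeasureTheory.integral_finsetSum_measure]
    · refine Finset.sum_congr rfl fun a _ => ?_
      rw [MeasureTheory.integral_smul_measure, MeasureTheory.integral_dirac]
      simp [hw a]
    · intro a _
      exact (MeasureTheory.integrable_dirac (by simp)).smul_measure (by simp)
  have hp : MeasureTheory.IsProbabilityMeasure μ := by
    constructor
    simp only [μ, MeasureTheory.Measure.coe_finsetSum, Finset.sum_apply,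
      MeasureTheory.Measure.smul_apply, MeasureTheory.measure_univ, smul_eq_mul, mul_one]
    rw [← ENNReal.ofReal_sum_of_nonneg (fun a _ => hw a), hw1]; simp
  have hsub := ProbabilityTheory.hasSubgaussianMGF_of_mem_Icc (μ := μ) (X := f) (a := -1) (b := 1)
    (measurable_from_top).aemeasurable
    (Filter.Eventually.of_forall fun a => abs_le.mp (hf a))
  have h := hsub.mgf_le s
  rw [ProbabilityTheory.mgf, hinteg, hinteg] at h
  refine h.trans (le_of_eq ?_)
  congr 1
  have : ((‖(1:ℝ) - -1‖₊ : NNReal) : ℝ) = 2 := by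
    rw [coe_nnnorm]; norm_num
  push_cast
  simp only [coe_nnnorm] at this ⊢
  rw [this]; ring

lemma tail_bd {α : Type*} [Fintype α] (w f : α → ℝ) (hw : ∀ a, 0 ≤ w a)
    (hw1 : ∑ a, w a = 1) (hf : ∀ a, |f a| ≤ 1) (n : ℕ) (ε : ℝ) (hε : 0 ≤ ε) :
    ∑ x : Fin n → α, (if n * ε < ∑ k, (f (x k) - ∑ b, w b * f b) then ∏ k, w (x k) else 0)
      ≤ Real.exp (-(n * ε ^ 2 / 2)) := by
  set m := ∑ b, w b * f b with hm
  have h1 : ∀ x : Fin n → α,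
      (if n * ε < ∑ k, (f (x k) - m) then ∏ k, w (x k) else 0) ≤
        Real.exp (-(n * ε ^ 2)) * ∏ k, (w (x k) * Real.exp (ε * (f (x k) - m))) := by
    intro x
    have h0 : 0 ≤ ∏ k, w (x k) := Finset.prod_nonneg fun k _ => hw _
    rw [Finset.prod_mul_distrib, ← Real.exp_sum, ← Finset.mul_sum, mul_left_comm,
      ← Real.exp_add]
    split_ifs with h
    · apply le_mul_of_one_le_right h0
      apply Real.one_le_exp
      nlinarith
    · positivity
  refine (Finset.sum_le_sum fun x _ => h1 x).trans ?_
  rw [← Finset.mul_sum]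
  have h2 := Finset.sum_prod_piFinset (ι := Fin n) (Finset.univ : Finset α)
    (fun _ a => w a * Real.exp (ε * (f a - m)))
  rw [Fintype.piFinset_univ] at h2
  rw [h2, Finset.prod_const, Finset.card_univ, Fintype.card_fin]
  have h3 := hoeff w f hw hw1 hf ε
  rw [← hm] at h3
  have h4 : 0 ≤ ∑ a, w a * Real.exp (ε * (f a - m)) :=
    Finset.sum_nonneg fun a _ => mul_nonneg (hw a) (Real.exp_pos _).le
  have h5 := pow_le_pow_left₀ h4 h3 n
  rw [← Real.exp_nat_mul] at h5
  refine (mul_le_mul_of_nonneg_left h5 (Real.exp_pos _).le).trans (le_of_eq ?_)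
  rw [← Real.exp_add]; congr 1; ring

lemma spin_sq (b : Bool) : spin b * spin b = 1 := by
  cases b <;> simp [spin]

lemma spin_abs (b : Bool) : |spin b| = 1 := by
  cases b <;> simp [spin]

lemma spin_not (b : Bool) : spin (!b) = - spin b := by
  cases b <;> simp [spin]

lemma gibbs_nonneg {p : ℕ} (θ : Fin p → Fin p → ℝ) (σ) : 0 ≤ gibbs θ σ := by
  unfold gibbs; positivity

lemma gibbs_sum {p : ℕ} (θ : Fin p → Fin p → ℝ) : ∑ σ, gibbs θ σ = 1 := by
  unfold gibbs
  rw [← Finset.sum_div]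
  apply div_self
  exact (Finset.sum_pos (fun σ _ => Real.exp_pos _) Finset.univ_nonempty).ne'

/-- flip spin `i` -/
def flp {p : ℕ} (i : Fin p) (σ : Fin p → Bool) : Fin p → Bool := Function.update σ i (!(σ i))

lemma flp_flp {p : ℕ} (i : Fin p) (σ : Fin p → Bool) : flp i (flp i σ) = σ := by
  simp [flp]

lemma flp_sum {p : ℕ} (i : Fin p) (F : (Fin p → Bool) → ℝ) :
    ∑ σ, F (flp i σ) = ∑ σ, F σ :=
  Equiv.sum_comp (Function.Involutive.toPerm (flp i) (flp_flp i)) F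

lemma spin_flp {p : ℕ} (i j : Fin p) (σ : Fin p → Bool) :
    spin (flp i σ j) = spin (σ j) - (if j = i then 2 * spin (σ i) else 0) := by
  unfold flp
  by_cases h : j = i
  · subst h; simp [spin_not]; ring
  · simp [h]

lemma spin_flp_self {p : ℕ} (i : Fin p) (σ : Fin p → Bool) :
    spin (flp i σ i) = - spin (σ i) := by
  simp [flp, spin_not]

lemma spin_flp_ne {p : ℕ} (i j : Fin p) (h : j ≠ i) (σ : Fin p → Bool) :
    spin (flp i σ j) = spin (σ j) := by
  simp [flp, h]

/-- local field -/
def fld {p : ℕ} (θ : Fin p → Fin p → ℝ) (i : Fin p) (σ : Fin p → Bool) : ℝ :=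
  ∑ j, θ i j * spin (σ j)

lemma fld_flp {p : ℕ} (θ : Fin p → Fin p → ℝ) (i j : Fin p) (h : θ j i = 0)
    (σ : Fin p → Bool) : fld θ j (flp i σ) = fld θ j σ := by
  unfold fld
  refine Finset.sum_congr rfl fun k _ => ?_
  by_cases hk : k = i
  · subst hk; simp [h]
  · rw [spin_flp_ne _ _ hk]

lemma ham_flp {p : ℕ} (θ : Fin p → Fin p → ℝ) (hsymm : ∀ i j, θ i j = θ j i)
    (hdiag : ∀ i, θ i i = 0) (i : Fin p) (σ : Fin p → Bool) :
    ham θ (flp i σ) = ham θ σ - 2 * (spin (σ i) * fld θ i σ) := by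
  unfold ham fld
  have h : ∀ a b, θ a b * spin (flp i σ a) * spin (flp i σ b) =
      θ a b * spin (σ a) * spin (σ b)
      - (if a = i then 2 * (spin (σ i) * (θ i b * spin (σ b))) else 0)
      - (if b = i then 2 * (spin (σ i) * (θ i a * spin (σ a))) else 0) := by
    intro a b
    rw [spin_flp, spin_flp]
    by_cases ha : a = i <;> by_cases hb : b = i
    · subst ha; subst hb; simp [hdiag]
    · subst ha; simp [hb]; ring
    · subst hb; simp [ha, hsymm a b]; ring
    · simp [ha, hb]
  simp only [h, Finset.sum_sub_distrib]
  rw [Finset.sum_comm (f := fun a b => if a = i then 2 * (spin (σ i) * (θ i b * spin (σ b))) else 0)]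
  simp only [Finset.sum_ite_eq', Finset.mem_univ, if_true, ← Finset.mul_sum]
  ring

lemma gibbs_flp {p : ℕ} (θ : Fin p → Fin p → ℝ) (hsymm : ∀ i j, θ i j = θ j i)
    (hdiag : ∀ i, θ i i = 0) (i : Fin p) (σ : Fin p → Bool) :
    gibbs θ (flp i σ) = gibbs θ σ * Real.exp (-(spin (σ i) * fld θ i σ)) ^ 2 := by
  unfold gibbs
  rw [ham_flp θ hsymm hdiag, ← Real.exp_nat_mul, div_mul_eq_mul_div, ← Real.exp_add]
  congr 2; push_cast; ring

/-- screened spin -/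
def xi {p : ℕ} (θ : Fin p → Fin p → ℝ) (i : Fin p) (σ : Fin p → Bool) : ℝ :=
  spin (σ i) * Real.exp (-(spin (σ i) * fld θ i σ))

lemma xi_orth {p : ℕ} (θ : Fin p → Fin p → ℝ) (hsymm : ∀ i j, θ i j = θ j i)
    (hdiag : ∀ i, θ i i = 0) (i : Fin p) (g : (Fin p → Bool) → ℝ)
    (hg : ∀ σ, g (flp i σ) = g σ) : ∑ σ, gibbs θ σ * (xi θ i σ * g σ) = 0 := by
  have h := flp_sum i (fun σ => gibbs θ σ * (xi θ i σ * g σ))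
  have h2 : ∀ σ, gibbs θ (flp i σ) * (xi θ i (flp i σ) * g (flp i σ)) =
      - (gibbs θ σ * (xi θ i σ * g σ)) := by
    intro σ
    rw [hg, gibbs_flp θ hsymm hdiag]
    unfold xi
    rw [spin_flp_self, fld_flp θ i i (hdiag i)]
    have : Real.exp (-(spin (σ i) * fld θ i σ)) * Real.exp (-(-spin (σ i) * fld θ i σ)) = 1 := by
      rw [← Real.exp_add]; simp
    linear_combination (-gibbs θ σ * spin (σ i) * g σ *
      Real.exp (-(spin (σ i) * fld θ i σ))) * this
  simp only [h2, Finset.sum_neg_distrib] at h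
  linarith

lemma xi_sq {p : ℕ} (θ : Fin p → Fin p → ℝ) (hsymm : ∀ i j, θ i j = θ j i)
    (hdiag : ∀ i, θ i i = 0) (i : Fin p) : ∑ σ, gibbs θ σ * (xi θ i σ) ^ 2 = 1 := by
  rw [← gibbs_sum θ, ← flp_sum i (gibbs θ)]
  refine Finset.sum_congr rfl fun σ _ => ?_
  rw [gibbs_flp θ hsymm hdiag]
  unfold xi
  rw [mul_pow, pow_two (spin _), spin_sq, one_mul]

lemma fld_bd {p : ℕ} (d : ℕ) (β : ℝ) (θ : Fin p → Fin p → ℝ)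
    (hdeg : ∀ i, (Finset.univ.filter fun j => θ i j ≠ 0).card ≤ d)
    (hβ : ∀ i j, |θ i j| ≤ β) (i : Fin p) (σ : Fin p → Bool) :
    |spin (σ i) * fld θ i σ| ≤ β * d := by
  have hb : 0 ≤ β := (abs_nonneg _).trans (hβ i i)
  rw [abs_mul, spin_abs, one_mul]
  unfold fld
  calc |∑ j, θ i j * spin (σ j)| ≤ ∑ j, |θ i j * spin (σ j)| := Finset.abs_sum_le_sum_abs _ _
    _ = ∑ j, |θ i j| := by simp [abs_mul, spin_abs]
    _ ≤ ∑ j, if θ i j ≠ 0 then β else 0 := by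
        refine Finset.sum_le_sum fun j _ => ?_
        split_ifs with h
        · exact hβ i j
        · push Not at h; simp [h]
    _ = ((Finset.univ.filter fun j => θ i j ≠ 0).card : ℝ) * β := by
        rw [← Finset.sum_filter]; simp
    _ ≤ β * d := by
        rw [mul_comm]
        exact mul_le_mul_of_nonneg_left (by exact_mod_cast hdeg i) hb

lemma bilin {α ι : Type*} [Fintype α] [Fintype ι] (w : α → ℝ) (x : ι → ℝ) (F G : ι → α → ℝ) :
    ∑ a, w a * ((∑ i, x i * F i a) * ∑ i, x i * G i a) =
      ∑ i, ∑ j, x i * x j * ∑ a, w a * (F i a * G j a) := by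
  have h : ∀ a, w a * ((∑ i, x i * F i a) * ∑ i, x i * G i a) =
      ∑ i, ∑ j, x i * x j * (w a * (F i a * G j a)) := by
    intro a
    rw [Finset.sum_mul_sum, Finset.mul_sum]
    refine Finset.sum_congr rfl fun i _ => ?_
    rw [Finset.mul_sum]
    exact Finset.sum_congr rfl fun j _ => by ring
  simp only [h]
  rw [Finset.sum_comm]
  refine Finset.sum_congr rfl fun i _ => ?_
  rw [Finset.sum_comm]
  exact Finset.sum_congr rfl fun j _ => by rw [Finset.mul_sum]

lemma cov_bd {p : ℕ} (d : ℕ) (β : ℝ) (θ : Fin p → Fin p → ℝ)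
    (hsymm : ∀ i j, θ i j = θ j i) (hdiag : ∀ i, θ i i = 0)
    (hdeg : ∀ i, (Finset.univ.filter fun j => θ i j ≠ 0).card ≤ d)
    (hβ : ∀ i j, |θ i j| ≤ β) (x : Fin p → ℝ) :
    Real.exp (-(2 * β * d)) / (d + 1) * ∑ i, x i ^ 2 ≤
      ∑ σ, gibbs θ σ * (∑ i, x i * spin (σ i)) ^ 2 := by
  set c := Real.exp (-(β * d)) with hc
  set S := ∑ i, x i ^ 2 with hS
  -- cross term
  have hcross : c * S ≤ ∑ σ, gibbs θ σ * ((∑ i, x i * spin (σ i)) * ∑ i, x i * xi θ i σ) := by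
    have e1 : ∑ σ, gibbs θ σ * ((∑ i, x i * spin (σ i)) * ∑ i, x i * xi θ i σ) =
        ∑ i, ∑ j, x i * x j * ∑ σ, gibbs θ σ * (xi θ i σ * spin (σ j)) := by
      have hb := bilin (gibbs θ) x (fun i σ => xi θ i σ) (fun j σ => spin (σ j))
      rw [← hb]
      exact Finset.sum_congr rfl fun σ _ => by ring
    rw [e1, hS, Finset.mul_sum]
    refine Finset.sum_le_sum fun i _ => ?_
    rw [Finset.sum_eq_single i]
    · have : c ≤ ∑ σ, gibbs θ σ * (xi θ i σ * spin (σ i)) := by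
        rw [← mul_one c, ← gibbs_sum θ, Finset.mul_sum]
        refine Finset.sum_le_sum fun σ _ => ?_
        rw [mul_comm]
        refine mul_le_mul_of_nonneg_left ?_ (gibbs_nonneg θ σ)
        unfold xi
        rw [mul_right_comm, spin_sq, one_mul]
        apply Real.exp_le_exp.mpr
        have := (abs_le.mp (fld_bd d β θ hdeg hβ i σ)).2
        linarith
      nlinarith [mul_le_mul_of_nonneg_left this (sq_nonneg (x i))]
    · intro j _ hj
      rw [xi_orth θ hsymm hdiag i (fun σ => spin (σ j)) (fun σ => spin_flp_ne i j hj σ), mul_zero]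
    · simp
  have hquad : ∑ σ, gibbs θ σ * (∑ i, x i * xi θ i σ) ^ 2 ≤ (d + 1) * S := by
    have e1 : ∑ σ, gibbs θ σ * (∑ i, x i * xi θ i σ) ^ 2 =
        ∑ i, ∑ j, ∑ σ, gibbs θ σ * (xi θ i σ * xi θ j σ) * (x i * x j) := by
      have hb := bilin (gibbs θ) x (fun i σ => xi θ i σ) (fun j σ => xi θ j σ)
      simp only [pow_two]
      rw [hb]
      refine Finset.sum_congr rfl fun i _ => Finset.sum_congr rfl fun j _ => ?_
      rw [← Finset.sum_mul, mul_comm]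
    have hterm : ∀ i j, ∑ σ, gibbs θ σ * (xi θ i σ * xi θ j σ) * (x i * x j) ≤
        (if i = j ∨ θ i j ≠ 0 then (x i ^ 2 / 2 + x j ^ 2 / 2) else 0) := by
      intro i j
      split_ifs with h
      · have a1 : x i ^ 2 / 2 + x j ^ 2 / 2 = ∑ σ, gibbs θ σ *
            ((xi θ i σ) ^ 2 * (x i ^ 2 / 2) + (xi θ j σ) ^ 2 * (x j ^ 2 / 2)) := by
          simp only [mul_add, Finset.sum_add_distrib, ← mul_assoc, ← Finset.sum_mul,
            xi_sq θ hsymm hdiag, one_mul]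
        rw [a1]
        refine Finset.sum_le_sum fun σ _ => ?_
        rw [mul_assoc]
        refine mul_le_mul_of_nonneg_left ?_ (gibbs_nonneg θ σ)
        nlinarith [sq_nonneg (xi θ i σ * x i - xi θ j σ * x j)]
      · push Not at h
        rw [← Finset.sum_mul, xi_orth θ hsymm hdiag i (xi θ j), zero_mul]
        intro σ
        unfold xi
        rw [spin_flp_ne i j (Ne.symm h.1), fld_flp θ i j (by rw [hsymm]; exact h.2)]
    rw [e1]
    refine (Finset.sum_le_sum fun i _ => Finset.sum_le_sum fun j _ => hterm i j).trans ?_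
    have hsplit : ∀ i j, (if i = j ∨ θ i j ≠ 0 then (x i ^ 2 / 2 + x j ^ 2 / 2) else 0) =
        (if i = j ∨ θ i j ≠ 0 then x i ^ 2 / 2 else 0) +
        (if i = j ∨ θ i j ≠ 0 then x j ^ 2 / 2 else 0) := by
      intro i j; split_ifs <;> simp
    have hrow : ∑ i, ∑ j, (if i = j ∨ θ i j ≠ 0 then x i ^ 2 / 2 else 0) ≤ (d + 1) * S / 2 := by
      rw [hS, Finset.mul_sum, Finset.sum_div]
      refine Finset.sum_le_sum fun i _ => ?_
      rw [← Finset.sum_filter, Finset.sum_const, nsmul_eq_mul]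
      have hcard : (Finset.univ.filter fun j => i = j ∨ θ i j ≠ 0).card ≤ d + 1 := by
        rw [Finset.filter_or]
        refine (Finset.card_union_le _ _).trans ?_
        have h1 : (Finset.univ.filter (Eq i)).card ≤ 1 := by
          rw [Finset.card_le_one]
          intro a ha b hb
          simp only [Finset.mem_filter, Finset.mem_univ, true_and] at ha hb
          rw [← ha, ← hb]
        rw [add_comm d 1]
        exact add_le_add h1 (hdeg i)
      have hcard' : ((Finset.univ.filter fun j => i = j ∨ θ i j ≠ 0).card : ℝ) ≤ d + 1 := by
        exact_mod_cast hcard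
      nlinarith [sq_nonneg (x i)]
    have hcol : ∑ i, ∑ j, (if i = j ∨ θ i j ≠ 0 then x j ^ 2 / 2 else 0) =
        ∑ i, ∑ j, (if i = j ∨ θ i j ≠ 0 then x i ^ 2 / 2 else 0) := by
      rw [Finset.sum_comm]
      refine Finset.sum_congr rfl fun i _ => Finset.sum_congr rfl fun j _ => ?_
      rw [hsymm j i]; simp only [eq_comm]
    simp only [hsplit, Finset.sum_add_distrib]
    rw [hcol]; linarith
  set t := c / (d + 1) with ht
  have hd : (0:ℝ) < d + 1 := by positivity
  have hc0 : 0 < c := Real.exp_pos _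
  have ht0 : 0 ≤ t := by positivity
  have hnn : 0 ≤ ∑ σ, gibbs θ σ * ((∑ i, x i * spin (σ i)) - t * ∑ i, x i * xi θ i σ) ^ 2 :=
    Finset.sum_nonneg fun σ _ => mul_nonneg (gibbs_nonneg θ σ) (sq_nonneg _)
  have hexp : ∑ σ, gibbs θ σ * ((∑ i, x i * spin (σ i)) - t * ∑ i, x i * xi θ i σ) ^ 2 =
      ∑ σ, gibbs θ σ * (∑ i, x i * spin (σ i)) ^ 2
      - 2 * t * ∑ σ, gibbs θ σ * ((∑ i, x i * spin (σ i)) * ∑ i, x i * xi θ i σ)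
      + t ^ 2 * ∑ σ, gibbs θ σ * (∑ i, x i * xi θ i σ) ^ 2 := by
    rw [Finset.mul_sum, Finset.mul_sum, ← Finset.sum_sub_distrib, ← Finset.sum_add_distrib]
    refine Finset.sum_congr rfl fun σ _ => by ring
  have hcc : Real.exp (-(2 * β * d)) / (d + 1) = 2 * t * c - t ^ 2 * (d + 1) := by
    have : Real.exp (-(2 * β * d)) = c ^ 2 := by
      rw [hc, ← Real.exp_nat_mul]; congr 1; push_cast; ring
    rw [this, ht]; field_simp; ring
  rw [hcc]
  have b1 := mul_le_mul_of_nonneg_left hcross (by positivity : 0 ≤ 2 * t)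
  have b2 := mul_le_mul_of_nonneg_left hquad (sq_nonneg t)
  nlinarith

lemma determ {p : ℕ} (n d : ℕ) (hn : 0 < n) (hd : 0 < d) (β R : ℝ) (θ : Fin p → Fin p → ℝ)
    (hsymm : ∀ i j, θ i j = θ j i) (hdiag : ∀ i, θ i i = 0)
    (hdeg : ∀ i, (Finset.univ.filter fun j => θ i j ≠ 0).card ≤ d)
    (hβ : ∀ i j, |θ i j| ≤ β) (u : Fin p) (hR : 0 < R) (σs : Fin n → Fin p → Bool)
    (hgood : ∀ i j, |∑ k, spin (σs k i) * spin (σs k j) -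
        n * ∑ σ, gibbs θ σ * (spin (σ i) * spin (σ j))| ≤
      n * (Real.exp (-(2 * β * d)) / (32 * d * (d + 1))))
    (Δ : Fin p → ℝ) (h1 : l1 u Δ ≤ 4 * Real.sqrt d * l2 u Δ) (h2 : l2 u Δ ≤ R) :
    ISO n σs u (fun i => θ u i + Δ i) - ISO n σs u (fun i => θ u i) -
            ∑ l ∈ Finset.univ.erase u, gradISO n σs u (fun i => θ u i) l * Δ l ≥
          Real.exp (-(3 * β * d)) / (4 * ((d : ℝ) + 1) * (1 + 2 * Real.sqrt d * R)) *
            l2 u Δ ^ 2 := by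
  set x : Fin p → ℝ := fun i => if i = u then 0 else Δ i with hx
  have es : ∀ F : Fin p → ℝ → ℝ, F u 0 = 0 →
      ∑ i ∈ Finset.univ.erase u, F i (Δ i) = ∑ i, F i (x i) := by
    intro F hF
    rw [← Finset.sum_erase (a := u) Finset.univ (by simpa [hx] using hF)]
    refine Finset.sum_congr rfl fun i hi => ?_
    simp [hx, (Finset.mem_erase.mp hi).1]
  set L := l2 u Δ with hL
  have hL0 : 0 ≤ L := Real.sqrt_nonneg _
  have hLsq : L ^ 2 = ∑ i, x i ^ 2 := by
    rw [hL, l2, Real.sq_sqrt (Finset.sum_nonneg fun i _ => sq_nonneg _)]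
    exact es (fun _ y => y ^ 2) (by simp)
  have hl1 : l1 u Δ = ∑ i, |x i| := es (fun _ y => |y|) (by simp)
  rw [hl1] at h1
  have hsd : Real.sqrt d ^ 2 = d := Real.sq_sqrt (by positivity)
  have hsd0 : 0 ≤ Real.sqrt d := Real.sqrt_nonneg _
  have hA0 : 0 ≤ ∑ i, |x i| := Finset.sum_nonneg fun i _ => abs_nonneg _
  have hn' : (0:ℝ) < n := by exact_mod_cast hn
  have hd' : (0:ℝ) < d := by exact_mod_cast hd
  -- quadratic form of empirical covariance
  have hq : n * (Real.exp (-(2 * β * d)) / (2 * (d + 1))) * L ^ 2 ≤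
      ∑ k, (∑ i, x i * spin (σs k i)) ^ 2 := by
    have c1 := cov_bd d β θ hsymm hdiag hdeg hβ x
    have q1 := bilin (fun _ : Fin n => (1:ℝ)) x (fun i k => spin (σs k i)) (fun i k => spin (σs k i))
    have q2 := bilin (gibbs θ) x (fun i σ => spin (σ i)) (fun i σ => spin (σ i))
    simp only [one_mul, ← pow_two] at q1 q2
    rw [q2] at c1
    rw [q1]
    have hdiff : n * ∑ i, ∑ j, x i * x j * ∑ σ, gibbs θ σ * (spin (σ i) * spin (σ j)) -
        ∑ i, ∑ j, x i * x j * ∑ k, spin (σs k i) * spin (σs k j) ≤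
        n * (Real.exp (-(2 * β * d)) / (32 * d * (d + 1))) * (∑ i, |x i|) ^ 2 := by
      rw [pow_two, Finset.sum_mul_sum, Finset.mul_sum, Finset.mul_sum, ← Finset.sum_sub_distrib]
      refine Finset.sum_le_sum fun i _ => ?_
      rw [Finset.mul_sum, Finset.mul_sum, ← Finset.sum_sub_distrib]
      refine Finset.sum_le_sum fun j _ => ?_
      set M := ∑ σ, gibbs θ σ * (spin (σ i) * spin (σ j))
      set N := ∑ k, spin (σs k i) * spin (σs k j)
      have hg := hgood i j
      calc n * (x i * x j * M) - x i * x j * N = (x i * x j) * (-(N - n * M)) := by ring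
        _ ≤ |(x i * x j) * (-(N - n * M))| := le_abs_self _
        _ = |x i| * |x j| * |N - n * M| := by rw [abs_mul, abs_mul, abs_neg]
        _ ≤ |x i| * |x j| * (n * (Real.exp (-(2 * β * d)) / (32 * d * (d + 1)))) :=
            mul_le_mul_of_nonneg_left hg (by positivity)
        _ = _ := by ring
    have hA : (∑ i, |x i|) ^ 2 ≤ 16 * d * L ^ 2 := by
      have := pow_le_pow_left₀ hA0 h1 2
      nlinarith
    have hB := mul_le_mul_of_nonneg_left hA
      (by positivity : 0 ≤ n * (Real.exp (-(2 * β * d)) / (32 * d * (d + 1))))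
    have hC := mul_le_mul_of_nonneg_left c1 hn'.le
    rw [← hLsq] at hC
    have e1 : n * (Real.exp (-(2 * β * d)) / (32 * d * (d + 1))) * (16 * d * L ^ 2) =
        n * (Real.exp (-(2 * β * d)) / (2 * (d + 1))) * L ^ 2 := by
      field_simp; ring
    have e2 : n * (Real.exp (-(2 * β * d)) / (d + 1) * L ^ 2) =
        2 * (n * (Real.exp (-(2 * β * d)) / (2 * (d + 1))) * L ^ 2) := by
      field_simp
    linarith
  -- rewrite the remainder
  set A : Fin n → ℝ := fun k =>
    ∑ i ∈ Finset.univ.erase u, θ u i * spin (σs k u) * spin (σs k i) with hAdef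
  set z : Fin n → ℝ := fun k => ∑ i ∈ Finset.univ.erase u, Δ i * spin (σs k u) * spin (σs k i)
    with hz
  have hrem : ISO n σs u (fun i => θ u i + Δ i) - ISO n σs u (fun i => θ u i) -
            ∑ l ∈ Finset.univ.erase u, gradISO n σs u (fun i => θ u i) l * Δ l =
      (1 / n : ℝ) * ∑ k, Real.exp (-A k) * (Real.exp (-z k) - 1 + z k) := by
    have g1 : ∑ l ∈ Finset.univ.erase u, gradISO n σs u (fun i => θ u i) l * Δ l =
        (1 / n : ℝ) * ∑ k, -(Real.exp (-A k) * z k) := by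
      unfold gradISO
      have : ∀ k, -(Real.exp (-A k) * z k) = ∑ l ∈ Finset.univ.erase u,
          (-(spin (σs k u) * spin (σs k l))) * Real.exp (-A k) * Δ l := by
        intro k
        simp only [hz]
        rw [Finset.mul_sum, ← Finset.sum_neg_distrib]
        exact Finset.sum_congr rfl fun l _ => by ring
      simp only [this]
      rw [Finset.sum_comm, Finset.mul_sum]
      refine Finset.sum_congr rfl fun l _ => ?_
      rw [mul_assoc, Finset.sum_mul]
    rw [g1]
    unfold ISO
    rw [← mul_sub, ← mul_sub, ← Finset.sum_sub_distrib, ← Finset.sum_sub_distrib]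
    congr 1
    refine Finset.sum_congr rfl fun k _ => ?_
    have : ∑ i ∈ Finset.univ.erase u, (θ u i + Δ i) * spin (σs k u) * spin (σs k i) =
        A k + z k := by
      simp only [hAdef, hz, add_mul, Finset.sum_add_distrib]
    rw [this, neg_add, Real.exp_add]
    ring
  rw [hrem]
  have hz2 : ∀ k, z k = spin (σs k u) * ∑ i, x i * spin (σs k i) := by
    intro k
    have := es (fun i y => y * spin (σs k u) * spin (σs k i)) (by simp)
    simp only [hz]
    rw [this, Finset.mul_sum]
    exact Finset.sum_congr rfl fun i _ => by ring
  have hzsq : ∀ k, z k ^ 2 = (∑ i, x i * spin (σs k i)) ^ 2 := by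
    intro k
    rw [hz2, mul_pow, pow_two (spin _), spin_sq, one_mul]
  have hzabs : ∀ k, |z k| ≤ 4 * Real.sqrt d * R := by
    intro k
    rw [hz2, abs_mul, spin_abs, one_mul]
    calc |∑ i, x i * spin (σs k i)| ≤ ∑ i, |x i * spin (σs k i)| := Finset.abs_sum_le_sum_abs _ _
      _ = ∑ i, |x i| := by simp [abs_mul, spin_abs]
      _ ≤ 4 * Real.sqrt d * L := h1
      _ ≤ 4 * Real.sqrt d * R := mul_le_mul_of_nonneg_left h2 (by positivity)
  have hAbd : ∀ k, Real.exp (-(β * d)) ≤ Real.exp (-A k) := by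
    intro k
    apply Real.exp_le_exp.mpr
    have e : A k = spin (σs k u) * fld θ u (σs k) := by
      simp only [hAdef, fld]
      rw [Finset.sum_erase _ (by simp [hdiag]), Finset.mul_sum]
      exact Finset.sum_congr rfl fun i _ => by ring
    have := (abs_le.mp (fld_bd d β θ hdeg hβ u (σs k))).2
    rw [e]; linarith
  have hterm : ∀ k, Real.exp (-(β * d)) / (2 + 4 * Real.sqrt d * R) *
      (∑ i, x i * spin (σs k i)) ^ 2 ≤ Real.exp (-A k) * (Real.exp (-z k) - 1 + z k) := by
    intro k
    rw [← hzsq]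
    have s1 := screen_ineq (z k)
    have s2 : z k ^ 2 / (2 + 4 * Real.sqrt d * R) ≤ z k ^ 2 / (2 + |z k|) :=
      div_le_div_of_nonneg_left (sq_nonneg _) (by positivity) (by linarith [hzabs k])
    calc _ = Real.exp (-(β * d)) * (z k ^ 2 / (2 + 4 * Real.sqrt d * R)) := by ring
      _ ≤ _ := mul_le_mul (hAbd k) (s2.trans s1) (by positivity) (Real.exp_pos _).le
  have hsum := Finset.sum_le_sum fun k (_ : k ∈ Finset.univ) => hterm k
  rw [← Finset.mul_sum] at hsum
  have hC0 : 0 ≤ Real.exp (-(β * d)) / (2 + 4 * Real.sqrt d * R) := by positivity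
  have hfin := (mul_le_mul_of_nonneg_left hq hC0).trans hsum
  have hfin2 := mul_le_mul_of_nonneg_left hfin (by positivity : (0:ℝ) ≤ 1 / n)
  refine le_trans (le_of_eq ?_) hfin2
  have : Real.exp (-(3 * β * d)) = Real.exp (-(β * d)) * Real.exp (-(2 * β * d)) := by
    rw [← Real.exp_add]; congr 1; ring
  rw [this]
  have h3 : 1 + 2 * Real.sqrt d * R ≠ 0 := by positivity
  have h4 : 2 + 4 * Real.sqrt d * R = 2 * (1 + 2 * Real.sqrt d * R) := by ring
  rw [h4]
  field_simp
  ring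

/-- **Lemma 8 (restricted strong convexity of the ISO).**
Let `σ^(1), …, σ^(n)` be i.i.d. samples from a zero-field Ising model on `p` spins with
maximum degree `d` and maximum coupling intensity `β`, and fix a node `u`. For any `ε₄ > 0`
and `R > 0`, if `n ≥ 2¹¹ d² (d+1)² e^{4βd} ln(p²/ε₄)`, then with probability at least
`1 - ε₄` the ISO satisfies
`δS_n(Δ_u, θ*_u) ≥ (e^{-3βd} / (4(d+1)(1+2√d R))) ‖Δ_u‖₂²`
simultaneously for all `Δ_u` with `‖Δ_u‖₁ ≤ 4√d ‖Δ_u‖₂` and `‖Δ_u‖₂ ≤ R`. -/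
theorem stmt12 {p : ℕ} (n d : ℕ) (β ε₄ R : ℝ) (θ : Fin p → Fin p → ℝ)
    (hsymm : ∀ i j, θ i j = θ j i) (hdiag : ∀ i, θ i i = 0)
    (hdeg : ∀ i, (Finset.univ.filter fun j => θ i j ≠ 0).card ≤ d)
    (hβ : ∀ i j, |θ i j| ≤ β)
    (u : Fin p) (hε₄ : 0 < ε₄) (hR : 0 < R)
    (hn : (n : ℝ) ≥
      2 ^ 11 * (d : ℝ) ^ 2 * ((d : ℝ) + 1) ^ 2 * Real.exp (4 * β * d) *
        Real.log ((p : ℝ) ^ 2 / ε₄)) :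
    probn θ n (fun σs =>
      ∀ Δ : Fin p → ℝ, l1 u Δ ≤ 4 * Real.sqrt d * l2 u Δ → l2 u Δ ≤ R →
        ISO n σs u (fun i => θ u i + Δ i) - ISO n σs u (fun i => θ u i) -
            ∑ l ∈ Finset.univ.erase u, gradISO n σs u (fun i => θ u i) l * Δ l ≥
          Real.exp (-(3 * β * d)) / (4 * ((d : ℝ) + 1) * (1 + 2 * Real.sqrt d * R)) *
            l2 u Δ ^ 2) ≥ 1 - ε₄ := by
  have hp : (1:ℝ) ≤ p := by exact_mod_cast (Fin.pos u)
  have hβ0 : 0 ≤ β := (abs_nonneg _).trans (hβ u u)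
  have hw0 : ∀ σs : Fin n → Fin p → Bool, 0 ≤ ∏ k, gibbs θ (σs k) := fun σs =>
    Finset.prod_nonneg fun k _ => gibbs_nonneg θ _
  have htot : ∑ σs : Fin n → Fin p → Bool, ∏ k, gibbs θ (σs k) = 1 := by
    have h2 := Finset.sum_prod_piFinset (ι := Fin n) (Finset.univ : Finset (Fin p → Bool))
      (fun _ a => gibbs θ a)
    rw [Fintype.piFinset_univ] at h2
    rw [h2, gibbs_sum]; simp
  rcases le_or_gt 1 ε₄ with hε1 | hε1
  · have : 0 ≤ probn θ n (fun σs =>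
      ∀ Δ : Fin p → ℝ, l1 u Δ ≤ 4 * Real.sqrt d * l2 u Δ → l2 u Δ ≤ R →
        ISO n σs u (fun i => θ u i + Δ i) - ISO n σs u (fun i => θ u i) -
            ∑ l ∈ Finset.univ.erase u, gradISO n σs u (fun i => θ u i) l * Δ l ≥
          Real.exp (-(3 * β * d)) / (4 * ((d : ℝ) + 1) * (1 + 2 * Real.sqrt d * R)) *
            l2 u Δ ^ 2) := by
      unfold probn
      refine Finset.sum_nonneg fun σs _ => ?_
      split_ifs
      · exact hw0 σs
      · exact le_rfl
    linarith
  rcases Nat.eq_zero_or_pos d with hd | hd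
  · subst hd
    unfold probn
    rw [Finset.sum_congr rfl (fun σs _ => if_pos ?_), htot]
    · linarith
    · intro Δ h1 _
      simp only [Nat.cast_zero, Real.sqrt_zero, mul_zero, zero_mul, l1] at h1
      have hz : ∀ i ∈ Finset.univ.erase u, Δ i = 0 := by
        intro i hi
        have h3 := le_antisymm h1 (Finset.sum_nonneg fun i _ => abs_nonneg _)
        rw [Finset.sum_eq_zero_iff_of_nonneg (fun i _ => abs_nonneg _)] at h3
        exact abs_eq_zero.mp (h3 i hi)
      have e1 : l2 u Δ = 0 := by
        unfold l2
        rw [Finset.sum_eq_zero fun i hi => by rw [hz i hi]; simp]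
        simp
      have e2 : ∑ l ∈ Finset.univ.erase u, gradISO n σs u (fun i => θ u i) l * Δ l = 0 :=
        Finset.sum_eq_zero fun i hi => by rw [hz i hi]; simp
      have e3 : ISO n σs u (fun i => θ u i + Δ i) = ISO n σs u (fun i => θ u i) := by
        unfold ISO
        congr 1
        refine Finset.sum_congr rfl fun k _ => ?_
        congr 2
        exact Finset.sum_congr rfl fun i hi => by simp [hz i hi]
      rw [e1, e2, e3]; simp
  have hd' : (0:ℝ) < d := by exact_mod_cast hd
  have hlog : 0 < Real.log ((p : ℝ) ^ 2 / ε₄) := by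
    apply Real.log_pos
    rw [lt_div_iff₀ hε₄]; nlinarith
  have hnpos : 0 < n := by
    have : (0:ℝ) < n := lt_of_lt_of_le (by positivity) hn
    exact_mod_cast this
  have hn' : (0:ℝ) < n := by exact_mod_cast hnpos
  set ε := Real.exp (-(2 * β * d)) / (32 * d * (d + 1)) with hε
  have hε0 : 0 < ε := by positivity
  -- signed pair observables
  let f : Fin p × Fin p → (Fin p → Bool) → ℝ := fun q σ =>
    (if q.1 < q.2 then 1 else -1) * (spin (σ q.1) * spin (σ q.2))
  have hf : ∀ q σ, |f q σ| ≤ 1 := by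
    intro q σ
    simp only [f]
    split_ifs <;> simp [abs_mul, spin_abs]
  let bad : Fin p × Fin p → (Fin n → Fin p → Bool) → Prop := fun q σs =>
    n * ε < ∑ k, (f q (σs k) - ∑ b, gibbs θ b * f q b)
  have hgood : ∀ σs, (∀ q, ¬ bad q σs) → ∀ i j, |∑ k, spin (σs k i) * spin (σs k j) -
        n * ∑ σ, gibbs θ σ * (spin (σ i) * spin (σ j))| ≤ n * ε := by
    intro σs hb i j
    have hfe : ∀ q : Fin p × Fin p, ∑ k, (f q (σs k) - ∑ b, gibbs θ b * f q b) =
        (if q.1 < q.2 then 1 else -1) * (∑ k, spin (σs k q.1) * spin (σs k q.2) -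
          n * ∑ σ, gibbs θ σ * (spin (σ q.1) * spin (σ q.2))) := by
      intro q
      simp only [f, Finset.sum_sub_distrib, mul_left_comm (gibbs θ _), ← Finset.mul_sum]
      simp only [Finset.sum_const, Finset.card_univ, Fintype.card_fin, nsmul_eq_mul]
      ring
    have hsw : ∀ (a b : Fin p) (τ : Fin p → Bool), spin (τ a) * spin (τ b) =
        spin (τ b) * spin (τ a) := fun a b τ => mul_comm _ _
    have main : ∀ a b : Fin p, a < b → |∑ k, spin (σs k a) * spin (σs k b) -
        n * ∑ σ, gibbs θ σ * (spin (σ a) * spin (σ b))| ≤ n * ε := by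
      intro a b hab
      have h1 := hb (a, b)
      have h2 := hb (b, a)
      simp only [bad, not_lt] at h1 h2
      rw [hfe] at h1 h2
      simp only [hab, if_true, not_lt_of_gt hab, if_false] at h1 h2
      simp only [hsw b a] at h2
      rw [abs_le]
      constructor <;> linarith
    rcases lt_trichotomy i j with h | h | h
    · exact main i j h
    · subst h
      simp only [spin_sq, mul_one, gibbs_sum]
      simp
      positivity
    · simp only [hsw i j]
      exact main j i h
  have hunion : ∑ q : Fin p × Fin p, ∑ σs : Fin n → Fin p → Bool,
      (if bad q σs then ∏ k, gibbs θ (σs k) else 0) ≤ ε₄ := by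
    have hb : ∀ q ∈ (Finset.univ : Finset (Fin p × Fin p)), ∑ σs : Fin n → Fin p → Bool,
      (if bad q σs then ∏ k, gibbs θ (σs k) else 0) ≤ Real.exp (-(n * ε ^ 2 / 2)) := fun q _ =>
        tail_bd (gibbs θ) (f q) (gibbs_nonneg θ) (gibbs_sum θ) (hf q) n ε hε0.le
    refine (Finset.sum_le_card_nsmul _ _ _ hb).trans ?_
    rw [Finset.card_univ, Fintype.card_prod, Fintype.card_fin, nsmul_eq_mul]
    push_cast
    have hle : Real.log ((p : ℝ) ^ 2 / ε₄) ≤ n * ε ^ 2 / 2 := by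
      have e1 : ε ^ 2 / 2 * (2 ^ 11 * (d : ℝ) ^ 2 * ((d : ℝ) + 1) ^ 2 * Real.exp (4 * β * d)) = 1 := by
        have : Real.exp (-(2 * β * d)) ^ 2 * Real.exp (4 * β * d) = 1 := by
          rw [← Real.exp_nat_mul, ← Real.exp_add, ← Real.exp_zero]
          congr 1; push_cast; ring
        rw [hε, div_pow]
        generalize Real.exp (-(2 * β * d)) = X at this ⊢
        generalize Real.exp (4 * β * d) = Y at this ⊢
        field_simp
        linear_combination (2 ^ 10) * this
      have := mul_le_mul_of_nonneg_left hn (by positivity : 0 ≤ ε ^ 2 / 2)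
      rw [← mul_assoc, e1] at this
      linarith
    have hp2 : (0:ℝ) < (p:ℝ) ^ 2 / ε₄ := by positivity
    have h3 : Real.exp (-(n * ε ^ 2 / 2)) ≤ ((p:ℝ) ^ 2 / ε₄)⁻¹ := by
      rw [← Real.exp_log hp2, ← Real.exp_neg]
      exact Real.exp_le_exp.mpr (by linarith)
    calc (p:ℝ) * p * Real.exp (-(n * ε ^ 2 / 2)) ≤ p * p * ((p:ℝ) ^ 2 / ε₄)⁻¹ :=
          mul_le_mul_of_nonneg_left h3 (by positivity)
      _ = ε₄ := by field_simp
  have hpt : ∑ σs : Fin n → Fin p → Bool, ∏ k, gibbs θ (σs k) ≤ probn θ n (fun σs =>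
      ∀ Δ : Fin p → ℝ, l1 u Δ ≤ 4 * Real.sqrt d * l2 u Δ → l2 u Δ ≤ R →
        ISO n σs u (fun i => θ u i + Δ i) - ISO n σs u (fun i => θ u i) -
            ∑ l ∈ Finset.univ.erase u, gradISO n σs u (fun i => θ u i) l * Δ l ≥
          Real.exp (-(3 * β * d)) / (4 * ((d : ℝ) + 1) * (1 + 2 * Real.sqrt d * R)) *
            l2 u Δ ^ 2) + ∑ q : Fin p × Fin p, ∑ σs : Fin n → Fin p → Bool,
      (if bad q σs then ∏ k, gibbs θ (σs k) else 0) := by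
    rw [Finset.sum_comm]
    unfold probn
    rw [← Finset.sum_add_distrib]
    refine Finset.sum_le_sum fun σs _ => ?_
    have hnn : ∀ q ∈ (Finset.univ : Finset (Fin p × Fin p)),
        0 ≤ (if bad q σs then ∏ k, gibbs θ (σs k) else 0) := by
      intro q _
      split_ifs
      · exact hw0 σs
      · exact le_rfl
    by_cases hb : ∀ q, ¬ bad q σs
    · rw [if_pos]
      · linarith [Finset.sum_nonneg hnn]
      · intro Δ h1 h2
        exact determ n d hnpos hd β R θ hsymm hdiag hdeg hβ u hR σs (hgood σs hb) Δ h1 h2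
    · push Not at hb
      obtain ⟨q, hq⟩ := hb
      have h1 := Finset.single_le_sum hnn (Finset.mem_univ q)
      rw [if_pos hq] at h1
      refine h1.trans (le_add_of_nonneg_left ?_)
      split_ifs
      · exact hw0 σs
      · exact le_rfl
  linarith
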